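/- Assume moreover that 𝒞 is a projective generator for 𝒜 (for every A∈𝒜 there is an exact sequence 0→A'→C→A→0 with C∈𝒞, and Ext^i_𝒜(C,A)=0 for all i≥1, C∈𝒞, A∈𝒜). Then spc(𝒢(𝒞)) is projectively resolving in 𝒜 (it contains all projective objects, is closed under extensions and under kernels of epimorphisms between its objects) and injectively coresolving in 𝒜 (it contains all injective objects, is closed under extensions and under cokernels of monomorphisms between its objects). -/

import Mathlib

open CategoryTheory CategoryTheory.Limits CategoryTheory.Abelian ZeroObject

universe w t v u

variable {A : Type u} [Category.{v} A] [Abelian A]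

/-- `f`, `g` form a short exact sequence `0 ⟶ X ⟶ Y ⟶ Z ⟶ 0` in `A`. -/
def IsSES {X Y Z : A} (f : X ⟶ Y) (g : Y ⟶ Z) : Prop :=
  ∃ hw : f ≫ g = 0, (ShortComplex.mk f g hw).ShortExact

/-- The short exact sequence `0 ⟶ X ⟶ Y ⟶ Z ⟶ 0` remains exact after applying
`Hom_A(C, -)` for every `C` in `𝒞`. -/
def HomLeftExact (𝒞 : A → Prop) {X Y Z : A} (f : X ⟶ Y) (g : Y ⟶ Z) : Prop :=
  ∀ ⦃C : A⦄, 𝒞 C →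
    Function.Injective (fun h : C ⟶ X => h ≫ f) ∧
    Function.Exact (fun h : C ⟶ X => h ≫ f) (fun h : C ⟶ Y => h ≫ g) ∧
    Function.Surjective (fun h : C ⟶ Y => h ≫ g)

/-- The short exact sequence `0 ⟶ X ⟶ Y ⟶ Z ⟶ 0` remains exact after applying
`Hom_A(-, C)` for every `C` in `𝒞`. -/
def HomRightExact (𝒞 : A → Prop) {X Y Z : A} (f : X ⟶ Y) (g : Y ⟶ Z) : Prop :=
  ∀ ⦃C : A⦄, 𝒞 C →
    Function.Injective (fun h : Z ⟶ C => g ≫ h) ∧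
    Function.Exact (fun h : Z ⟶ C => g ≫ h) (fun h : Y ⟶ C => f ≫ h) ∧
    Function.Surjective (fun h : Y ⟶ C => f ≫ h)

/-- `M` belongs to the Gorenstein subcategory `𝒢(𝒞)`: there is an exact sequence
`⋯ ⟶ C_1 ⟶ C_0 ⟶ C^0 ⟶ C^1 ⟶ ⋯` with all terms in `𝒞`, which remains exact after
applying `Hom_A(C,-)` and `Hom_A(-,C)` for every `C ∈ 𝒞`, such that
`M ≅ Im(C_0 ⟶ C^0)`. -/
def IsGorenstein (𝒞 : A → Prop) (M : A) : Prop :=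
  ∃ (X : ℤ → A) (d : ∀ n : ℤ, X n ⟶ X (n + 1)) (hw : ∀ n, d n ≫ d (n + 1) = 0),
    (∀ n, 𝒞 (X n)) ∧
    (∀ n, (ShortComplex.mk (d n) (d (n + 1)) (hw n)).Exact) ∧
    (∀ (n : ℤ) ⦃C : A⦄, 𝒞 C →
      Function.Exact (fun h : C ⟶ X n => h ≫ d n) (fun h : C ⟶ X (n + 1) => h ≫ d (n + 1))) ∧
    (∀ (n : ℤ) ⦃C : A⦄, 𝒞 C →
      Function.Exact (fun h : X (n + 1 + 1) ⟶ C => d (n + 1) ≫ h)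
        (fun h : X (n + 1) ⟶ C => d n ≫ h)) ∧
    Nonempty (M ≅ Limits.image (d 0))

/-- `𝒞` is a full additive subcategory closed under isomorphisms, encoded as a predicate
closed under isomorphisms, containing a zero object and closed under binary biproducts. -/
def IsAdditiveClosed (𝒞 : A → Prop) : Prop :=
  (∀ ⦃X Y : A⦄, (X ≅ Y) → 𝒞 X → 𝒞 Y) ∧ 𝒞 (0 : A) ∧ ∀ ⦃X Y : A⦄, 𝒞 X → 𝒞 Y → 𝒞 (X ⊞ Y)

/-- `𝒫(A)` is a generator for `𝒞`: for every `C ∈ 𝒞` there is a short exact sequence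
`0 ⟶ C' ⟶ P ⟶ C ⟶ 0` with `P` projective and `C' ∈ 𝒞`. -/
def ProjIsGeneratorFor (𝒞 : A → Prop) : Prop :=
  ∀ ⦃C : A⦄, 𝒞 C → ∃ (C' P : A) (f : C' ⟶ P) (g : P ⟶ C),
    Projective P ∧ 𝒞 C' ∧ IsSES f g

section Ext

variable [HasExt.{w} A]

/-- `𝒞` is self-orthogonal: `Ext^i(C, C') = 0` for all `i ≥ 1` and `C, C' ∈ 𝒞`. -/
def SelfOrthogonal (𝒞 : A → Prop) : Prop :=
  ∀ ⦃C C' : A⦄, 𝒞 C → 𝒞 C' → ∀ i : ℕ, 1 ≤ i → Subsingleton (Abelian.Ext C C' i)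

/-- `M ∈ 𝒢(𝒞)^{⊥1}`, i.e. `Ext^1(G, M) = 0` for every `G ∈ 𝒢(𝒞)`. -/
def RightPerp1 (𝒞 : A → Prop) (M : A) : Prop :=
  ∀ ⦃G : A⦄, IsGorenstein 𝒞 G → Subsingleton (Abelian.Ext G M 1)

/-- `f : G ⟶ M` is a special `𝒢(𝒞)`-precover of `M`. -/
def IsSpecialPrecover (𝒞 : A → Prop) {G M : A} (f : G ⟶ M) : Prop :=
  IsGorenstein 𝒞 G ∧ Epi f ∧ RightPerp1 𝒞 (kernel f) ∧
    ∀ ⦃G' : A⦄, IsGorenstein 𝒞 G' → Function.Surjective (fun h : G' ⟶ G => h ≫ f)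

/-- `M` belongs to the special precovered category `spc(𝒢(𝒞))`. -/
def HasSpecialPrecover (𝒞 : A → Prop) (M : A) : Prop :=
  ∃ (G : A) (f : G ⟶ M), IsSpecialPrecover 𝒞 f

/-- `𝒞` is a generator for `𝒢(𝒞)^{⊥1}`. -/
def GeneratorForPerp (𝒞 : A → Prop) : Prop :=
  ∀ ⦃T : A⦄, RightPerp1 𝒞 T → ∃ (T' C : A) (f : T' ⟶ C) (g : C ⟶ T),
    𝒞 C ∧ RightPerp1 𝒞 T' ∧ IsSES f g

end Ext

section ShortExactSequences

lemma IsSES.zero {X Y Z : A} {f : X ⟶ Y} {g : Y ⟶ Z} (h : IsSES f g) : f ≫ g = 0 := h.1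

lemma IsSES.mono {X Y Z : A} {f : X ⟶ Y} {g : Y ⟶ Z} (h : IsSES f g) : Mono f := h.2.mono_f

lemma IsSES.epi {X Y Z : A} {f : X ⟶ Y} {g : Y ⟶ Z} (h : IsSES f g) : Epi g := h.2.epi_g

lemma IsSES.exists_lift {X Y Z T : A} {f : X ⟶ Y} {g : Y ⟶ Z} (h : IsSES f g) (x : T ⟶ Y)
    (hx : x ≫ g = 0) : ∃ y : T ⟶ X, y ≫ f = x :=
  have : Mono (ShortComplex.mk f g h.1).f := h.mono
  ⟨h.2.exact.lift x hx, h.2.exact.lift_f x hx⟩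

lemma IsSES.exists_desc {X Y Z T : A} {f : X ⟶ Y} {g : Y ⟶ Z} (h : IsSES f g) (x : Y ⟶ T)
    (hx : f ≫ x = 0) : ∃ y : Z ⟶ T, g ≫ y = x :=
  have : Epi (ShortComplex.mk f g h.1).g := h.epi
  ⟨h.2.exact.desc x hx, h.2.exact.g_desc x hx⟩

lemma isSES_of_lift {X Y Z : A} {f : X ⟶ Y} {g : Y ⟶ Z} (hf : Mono f) (hg : Epi g)
    (hw : f ≫ g = 0) (hl : ∀ ⦃T : A⦄ (x : T ⟶ Y), x ≫ g = 0 → ∃ y : T ⟶ X, y ≫ f = x) :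
    IsSES f g := by
  refine ⟨hw, ShortComplex.ShortExact.mk' ?_ hf hg⟩
  rw [ShortComplex.exact_iff_exact_up_to_refinements]
  intro T x hx
  obtain ⟨y, hy⟩ := hl x hx
  exact ⟨T, 𝟙 T, inferInstance, y, by simpa using hy.symm⟩

lemma IsSES.op {X Y Z : A} {f : X ⟶ Y} {g : Y ⟶ Z} (h : IsSES f g) : IsSES g.op f.op :=
  ⟨by rw [← op_comp, h.1, op_zero], h.2.op⟩

lemma IsSES.unop {X Y Z : Aᵒᵖ} {f : X ⟶ Y} {g : Y ⟶ Z} (h : IsSES f g) :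
    IsSES g.unop f.unop :=
  ⟨by rw [← unop_comp, h.1, unop_zero], h.2.unop⟩

lemma isSES_of_desc {X Y Z : A} {f : X ⟶ Y} {g : Y ⟶ Z} (hf : Mono f) (hg : Epi g)
    (hw : f ≫ g = 0) (hl : ∀ ⦃T : A⦄ (x : Y ⟶ T), f ≫ x = 0 → ∃ y : Z ⟶ T, g ≫ y = x) :
    IsSES f g := by
  refine (isSES_of_lift (f := g.op) (g := f.op) inferInstance inferInstance
    (by rw [← op_comp, hw, op_zero]) ?_).unop
  intro T x hx
  obtain ⟨y, hy⟩ := hl x.unop (Quiver.Hom.op_inj hx)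
  exact ⟨y.op, Quiver.Hom.unop_inj hy⟩

lemma isSES_kernel {X Y : A} (g : X ⟶ Y) (hg : Epi g) : IsSES (kernel.ι g) g :=
  isSES_of_lift inferInstance hg (kernel.condition g)
    (fun _ x hx => ⟨kernel.lift g x hx, kernel.lift_ι g x hx⟩)

lemma IsSES.iso_left {X X' Y Z : A} {f : X ⟶ Y} {g : Y ⟶ Z} (h : IsSES f g) (e : X' ≅ X) :
    IsSES (e.hom ≫ f) g := by
  have := h.mono
  refine isSES_of_lift inferInstance h.epi (by rw [Category.assoc, h.zero, comp_zero]) ?_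
  intro T x hx
  obtain ⟨y, rfl⟩ := h.exists_lift x hx
  exact ⟨y ≫ e.inv, by simp⟩

lemma IsSES.of_isPullback {K X Y Z P : A} {fst : P ⟶ X} {snd : P ⟶ Y} {g : X ⟶ Z} {h : Y ⟶ Z}
    (sq : IsPullback fst snd g h) {k : K ⟶ X} (hk : IsSES k g) :
    ∃ k' : K ⟶ P, k' ≫ fst = k ∧ IsSES k' snd := by
  have h1 : sq.lift k 0 (by rw [hk.zero, zero_comp]) ≫ fst = k := sq.lift_fst _ _ _
  have h2 : sq.lift k 0 (by rw [hk.zero, zero_comp]) ≫ snd = 0 := sq.lift_snd _ _ _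
  have := hk.mono
  have := hk.epi
  refine ⟨_, h1, isSES_of_lift (mono_of_mono_fac h1) ?_ h2 ?_⟩
  · exact (MorphismProperty.epimorphisms A).of_isPullback sq this
  · intro T x hx
    obtain ⟨y, hy⟩ := hk.exists_lift (x ≫ fst)
      (by rw [Category.assoc, sq.w, ← Category.assoc, hx, zero_comp])
    refine ⟨y, sq.hom_ext ?_ ?_⟩
    · rw [Category.assoc, h1, hy]
    · rw [Category.assoc, h2, hx, comp_zero]

lemma IsSES.of_isPushout {X Y Z P C : A} {f : Z ⟶ X} {g : Z ⟶ Y} {inl : X ⟶ P} {inr : Y ⟶ P}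
    (sq : IsPushout f g inl inr) {p : X ⟶ C} (hp : IsSES f p) :
    ∃ p' : P ⟶ C, inl ≫ p' = p ∧ IsSES inr p' := by
  have h1 : inl ≫ sq.desc p 0 (by rw [hp.zero, comp_zero]) = p := sq.inl_desc _ _ _
  have h2 : inr ≫ sq.desc p 0 (by rw [hp.zero, comp_zero]) = 0 := sq.inr_desc _ _ _
  have := hp.epi
  have := hp.mono
  refine ⟨_, h1, isSES_of_desc ?_ (epi_of_epi_fac h1) h2 ?_⟩
  · exact (MorphismProperty.monomorphisms A).of_isPushout sq.flip this
  · intro T x hx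
    obtain ⟨y, hy⟩ := hp.exists_desc (inl ≫ x)
      (by rw [← Category.assoc, sq.w, Category.assoc, hx, comp_zero])
    refine ⟨y, sq.hom_ext ?_ ?_⟩
    · rw [← Category.assoc, h1, hy]
    · rw [← Category.assoc, h2, hx, zero_comp]

/-- The kernel of a composite of epimorphisms is an extension of the two kernels. -/
lemma IsSES.comp {K₁ K₂ X Y Z : A} {k₁ : K₁ ⟶ X} {g₁ : X ⟶ Y} {k₂ : K₂ ⟶ Y} {g₂ : Y ⟶ Z}
    (h₁ : IsSES k₁ g₁) (h₂ : IsSES k₂ g₂) :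
    ∃ (K : A) (k : K ⟶ X) (u : K₁ ⟶ K) (v : K ⟶ K₂), IsSES k (g₁ ≫ g₂) ∧ IsSES u v := by
  have sq := IsPullback.of_hasPullback g₁ k₂
  obtain ⟨u, -, hu⟩ := IsSES.of_isPullback sq h₁
  have := h₁.epi
  have := h₂.epi
  have := h₂.mono
  refine ⟨_, _, _, _, isSES_of_lift (f := pullback.fst g₁ k₂) inferInstance inferInstance ?_ ?_, hu⟩
  · rw [← Category.assoc, sq.w, Category.assoc, h₂.zero, comp_zero]
  · intro T x hx
    obtain ⟨y, hy⟩ := h₂.exists_lift (x ≫ g₁) (by rw [Category.assoc, hx])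
    exact ⟨sq.lift x y hy.symm, sq.lift_fst _ _ _⟩

/-- The kernels of a morphism of short exact sequences with epimorphic outer components form a
short exact sequence. -/
lemma IsSES.exists_kernels {X₁ X₂ X₃ Y₁ Y₂ Y₃ K₁ K₃ : A} {f : X₁ ⟶ X₂} {g : X₂ ⟶ X₃}
    {f' : Y₁ ⟶ Y₂} {g' : Y₂ ⟶ Y₃} {a : X₁ ⟶ Y₁} {b : X₂ ⟶ Y₂} {c : X₃ ⟶ Y₃}
    {k₁ : K₁ ⟶ X₁} {k₃ : K₃ ⟶ X₃}
    (h : IsSES f g) (h' : IsSES f' g') (hab : f ≫ b = a ≫ f') (hbc : g ≫ c = b ≫ g')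
    (ha : IsSES k₁ a) (hc : IsSES k₃ c) :
    ∃ (K₂ : A) (k₂ : K₂ ⟶ X₂) (u : K₁ ⟶ K₂) (v : K₂ ⟶ K₃), IsSES k₂ b ∧ IsSES u v := by
  have := h.mono
  have := h.epi
  have := h'.mono
  have := ha.mono
  have := ha.epi
  have := hc.mono
  have := hc.epi
  have hb : Epi b := by
    rw [epi_iff_surjective_up_to_refinements]
    intro T y
    obtain ⟨T₁, π, _, x, hx⟩ := surjective_up_to_refinements_of_epi (g ≫ c) (y ≫ g')
    obtain ⟨z, hz⟩ := h'.exists_lift (π ≫ y - x ≫ b)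
      (by simp only [Preadditive.sub_comp, Category.assoc, ← hbc, hx, sub_self])
    obtain ⟨T₂, π₂, _, w, hw⟩ := surjective_up_to_refinements_of_epi a z
    refine ⟨T₂, π₂ ≫ π, inferInstance, π₂ ≫ x + w ≫ f, ?_⟩
    rw [Preadditive.add_comp, Category.assoc, Category.assoc, Category.assoc, hab,
      ← Category.assoc w, ← hw, Category.assoc π₂, hz, Preadditive.comp_sub]
    abel
  have hk := isSES_kernel b hb
  obtain ⟨u, hu⟩ := hk.exists_lift (k₁ ≫ f)
    (by rw [Category.assoc, hab, ← Category.assoc, ha.zero, zero_comp])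
  obtain ⟨v, hv⟩ := hc.exists_lift (kernel.ι b ≫ g)
    (by rw [Category.assoc, hbc, ← Category.assoc, hk.zero, zero_comp])
  refine ⟨_, _, u, v, hk, isSES_of_lift ?_ ?_ ?_ ?_⟩
  · have : Mono (u ≫ kernel.ι b) := by rw [hu]; infer_instance
    exact mono_of_mono u (kernel.ι b)
  · rw [epi_iff_surjective_up_to_refinements]
    intro T y
    obtain ⟨T₁, π, _, x, hx⟩ := surjective_up_to_refinements_of_epi g (y ≫ k₃)
    obtain ⟨z, hz⟩ := h'.exists_lift (x ≫ b)
      (by rw [Category.assoc, ← hbc, ← Category.assoc, ← hx, Category.assoc, Category.assoc,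
        hc.zero, comp_zero, comp_zero])
    obtain ⟨T₂, π₂, _, w, hw⟩ := surjective_up_to_refinements_of_epi a z
    obtain ⟨t, ht⟩ := hk.exists_lift (π₂ ≫ x - w ≫ f) (by
      rw [Preadditive.sub_comp, Category.assoc, Category.assoc, hab, ← Category.assoc w, ← hw,
        Category.assoc π₂, hz, sub_self])
    refine ⟨T₂, π₂ ≫ π, inferInstance, t, ?_⟩
    rw [← cancel_mono k₃, Category.assoc t, hv, ← Category.assoc t, ht, Preadditive.sub_comp,
      Category.assoc w, h.zero, comp_zero, sub_zero, Category.assoc, Category.assoc,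
      Category.assoc, hx]
  · rw [← cancel_mono k₃, Category.assoc, hv, ← Category.assoc, hu, Category.assoc, h.zero,
      comp_zero, zero_comp]
  · intro T x hx
    obtain ⟨y, hy⟩ := h.exists_lift (x ≫ kernel.ι b)
      (by rw [Category.assoc, ← hv, ← Category.assoc, hx, zero_comp])
    obtain ⟨z, hz⟩ := ha.exists_lift y (by
      rw [← cancel_mono f', Category.assoc, ← hab, ← Category.assoc, hy, Category.assoc, hk.zero,
        comp_zero, zero_comp])
    refine ⟨z, ?_⟩
    rw [← cancel_mono (kernel.ι b), Category.assoc, hu, ← Category.assoc, hz, hy]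

/-- The cokernels of a morphism of short exact sequences with monomorphic outer components form
a short exact sequence. -/
lemma IsSES.exists_cokernels {X₁ X₂ X₃ Y₁ Y₂ Y₃ Q₁ Q₃ : A} {f : X₁ ⟶ X₂} {g : X₂ ⟶ X₃}
    {f' : Y₁ ⟶ Y₂} {g' : Y₂ ⟶ Y₃} {a : X₁ ⟶ Y₁} {b : X₂ ⟶ Y₂} {c : X₃ ⟶ Y₃}
    {q₁ : Y₁ ⟶ Q₁} {q₃ : Y₃ ⟶ Q₃}
    (h : IsSES f g) (h' : IsSES f' g') (hab : f ≫ b = a ≫ f') (hbc : g ≫ c = b ≫ g')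
    (ha : IsSES a q₁) (hc : IsSES c q₃) :
    ∃ (Q₂ : A) (q₂ : Y₂ ⟶ Q₂) (u : Q₁ ⟶ Q₂) (v : Q₂ ⟶ Q₃), IsSES b q₂ ∧ IsSES u v := by
  obtain ⟨K, k, u, v, hk, huv⟩ := IsSES.exists_kernels h'.op h.op (a := c.op) (b := b.op)
    (c := a.op) (by rw [← op_comp, ← op_comp, hbc]) (by rw [← op_comp, ← op_comp, hab])
    hc.op ha.op
  exact ⟨_, k.unop, v.unop, u.unop, hk.unop, huv.unop⟩

lemma isSES_biprod (X Y : A) : IsSES (biprod.inl : X ⟶ X ⊞ Y) (biprod.snd : X ⊞ Y ⟶ Y) := by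
  refine isSES_of_lift inferInstance inferInstance (by simp) fun T x hx => ⟨x ≫ biprod.fst, ?_⟩
  ext <;> simp [hx]

lemma isSES_id_zero (X : A) : IsSES (𝟙 X) (0 : X ⟶ 0) :=
  isSES_of_lift inferInstance ⟨fun _ _ _ => (isZero_zero A).eq_of_src _ _⟩ comp_zero
    fun _ x _ => ⟨x, Category.comp_id x⟩

lemma isSES_image {X Y Z : A} {f : X ⟶ Y} {g : Y ⟶ Z} (hw : f ≫ g = 0)
    (h : (ShortComplex.mk f g hw).Exact) :
    IsSES (Limits.image.ι f) (factorThruImage g) := by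
  have hz : Limits.image.ι f ≫ g = 0 := by
    rw [← cancel_epi (factorThruImage f), Limits.image.fac_assoc, hw, comp_zero]
  let φ : ShortComplex.mk f g hw ⟶ ShortComplex.mk (Limits.image.ι f) g hz :=
    { τ₁ := factorThruImage f, τ₂ := 𝟙 _, τ₃ := 𝟙 _ }
  have hφ₁ : Epi φ.τ₁ := inferInstanceAs (Epi (factorThruImage f))
  have hφ₂ : IsIso φ.τ₂ := inferInstanceAs (IsIso (𝟙 _))
  have hφ₃ : Mono φ.τ₃ := inferInstanceAs (Mono (𝟙 _))
  have hex := (ShortComplex.exact_iff_of_epi_of_isIso_of_mono φ).1 h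
  have : Mono (ShortComplex.mk (Limits.image.ι f) g hz).f := inferInstanceAs (Mono (Limits.image.ι f))
  have key : ∀ ⦃T : A⦄ (x : T ⟶ Y), x ≫ factorThruImage g = 0 → x ≫ g = 0 := fun T x hx => by
    rw [← Limits.image.fac g, ← Category.assoc, hx, zero_comp]
  refine isSES_of_lift inferInstance inferInstance ?_ fun T x hx =>
    ⟨hex.lift x (key x hx), hex.lift_f x (key x hx)⟩
  rw [← cancel_mono (Limits.image.ι g), Category.assoc, Limits.image.fac, hz, zero_comp]

end ShortExactSequences

section ExtSequences

variable [HasExt.{w} A]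

lemma IsSES.ext_middle_left {X Y Z T : A} {f : X ⟶ Y} {g : Y ⟶ Z} (h : IsSES f g) {i : ℕ}
    (h₁ : Subsingleton (Ext X T i)) (h₃ : Subsingleton (Ext Z T i)) :
    Subsingleton (Ext Y T i) := by
  refine subsingleton_of_forall_eq 0 fun x => ?_
  obtain ⟨y, rfl⟩ := Ext.contravariant_sequence_exact₂ h.2 T x (Subsingleton.elim _ _)
  rw [Subsingleton.elim y 0, Ext.comp_zero]

lemma IsSES.ext_left_of_middle {X Y Z T : A} {f : X ⟶ Y} {g : Y ⟶ Z} (h : IsSES f g) {i : ℕ}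
    (h₂ : Subsingleton (Ext Y T i)) (h₃ : Subsingleton (Ext Z T (1 + i))) :
    Subsingleton (Ext X T i) := by
  refine subsingleton_of_forall_eq 0 fun x => ?_
  obtain ⟨y, rfl⟩ := Ext.contravariant_sequence_exact₁ h.2 T x rfl (Subsingleton.elim _ _)
  rw [Subsingleton.elim y 0, Ext.comp_zero]

lemma IsSES.ext_right_of_left {X Y Z T : A} {f : X ⟶ Y} {g : Y ⟶ Z} (h : IsSES f g) {i : ℕ}
    (h₁ : Subsingleton (Ext X T i)) (h₂ : Subsingleton (Ext Y T (1 + i))) :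
    Subsingleton (Ext Z T (1 + i)) := by
  refine subsingleton_of_forall_eq 0 fun x => ?_
  obtain ⟨y, rfl⟩ := Ext.contravariant_sequence_exact₃ h.2 T x (Subsingleton.elim _ _) rfl
  rw [Subsingleton.elim y 0, Ext.comp_zero]

lemma IsSES.ext_right_of_extend {X Y Z T : A} {f : X ⟶ Y} {g : Y ⟶ Z} (h : IsSES f g)
    (h₁ : ∀ x : X ⟶ T, ∃ y : Y ⟶ T, f ≫ y = x) (h₂ : Subsingleton (Ext Y T 1)) :
    Subsingleton (Ext Z T 1) := by
  refine subsingleton_of_forall_eq 0 fun x => ?_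
  obtain ⟨y, rfl⟩ := Ext.contravariant_sequence_exact₃ h.2 T x (Subsingleton.elim _ _)
    (add_zero 1)
  obtain ⟨y, rfl⟩ := Ext.homEquiv₀.symm.surjective y
  obtain ⟨z, rfl⟩ := h₁ y
  exact (congrArg (fun t => h.2.extClass.comp t (add_zero 1))
    (Ext.mk₀_comp_mk₀ f z).symm).trans (h.2.extClass_comp_assoc _)

lemma IsSES.exists_extend {X Y Z T : A} {f : X ⟶ Y} {g : Y ⟶ Z} (h : IsSES f g)
    (h₃ : Subsingleton (Ext Z T 1)) (x : X ⟶ T) : ∃ y : Y ⟶ T, f ≫ y = x := by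
  obtain ⟨y, hy⟩ := Ext.contravariant_sequence_exact₁ h.2 T (Ext.mk₀ x) (add_zero 1)
    (Subsingleton.elim _ _)
  obtain ⟨y, rfl⟩ := Ext.homEquiv₀.symm.surjective y
  refine ⟨y, Ext.homEquiv₀.symm.injective ?_⟩
  exact (Ext.mk₀_comp_mk₀ f y).symm.trans hy

lemma IsSES.ext_middle_right {X Y Z G : A} {f : X ⟶ Y} {g : Y ⟶ Z} (h : IsSES f g) {i : ℕ}
    (h₁ : Subsingleton (Ext G X i)) (h₃ : Subsingleton (Ext G Z i)) :
    Subsingleton (Ext G Y i) := by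
  refine subsingleton_of_forall_eq 0 fun x => ?_
  obtain ⟨y, rfl⟩ := Ext.covariant_sequence_exact₂ G h.2 x (Subsingleton.elim _ _)
  rw [Subsingleton.elim y 0, Ext.zero_comp]

lemma IsSES.ext_target_right {X Y Z G : A} {f : X ⟶ Y} {g : Y ⟶ Z} (h : IsSES f g) {i : ℕ}
    (h₂ : Subsingleton (Ext G Y i)) (h₁ : Subsingleton (Ext G X (i + 1))) :
    Subsingleton (Ext G Z i) := by
  refine subsingleton_of_forall_eq 0 fun x => ?_
  obtain ⟨y, rfl⟩ := Ext.covariant_sequence_exact₃ G h.2 x rfl (Subsingleton.elim _ _)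
  rw [Subsingleton.elim y 0, Ext.zero_comp]

lemma IsSES.ext_target_left_of_lift {X Y Z G : A} {f : X ⟶ Y} {g : Y ⟶ Z} (h : IsSES f g)
    (h₃ : ∀ x : G ⟶ Z, ∃ y : G ⟶ Y, y ≫ g = x) (h₂ : Subsingleton (Ext G Y 1)) :
    Subsingleton (Ext G X 1) := by
  refine subsingleton_of_forall_eq 0 fun x => ?_
  obtain ⟨y, rfl⟩ := Ext.covariant_sequence_exact₁ G h.2 x (Subsingleton.elim _ _) (zero_add 1)
  obtain ⟨y, rfl⟩ := Ext.homEquiv₀.symm.surjective y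
  obtain ⟨z, rfl⟩ := h₃ y
  have h0 := h.2.comp_extClass
  have : (Ext.homEquiv₀.symm (z ≫ g) : Ext G Z 0) = (Ext.mk₀ z).comp (Ext.mk₀ g) (zero_add 0) :=
    (Ext.mk₀_comp_mk₀ z g).symm
  rw [this, Ext.comp_assoc (Ext.mk₀ z) (Ext.mk₀ g) h.2.extClass (zero_add 0) (zero_add 1)
    (by norm_num)]
  exact (congrArg (fun t => (Ext.mk₀ z).comp t (zero_add 1)) h0).trans (Ext.comp_zero _ _ _ _ _)

lemma IsSES.exists_lift_of_ext {X Y Z G : A} {f : X ⟶ Y} {g : Y ⟶ Z} (h : IsSES f g)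
    (h₁ : Subsingleton (Ext G X 1)) (x : G ⟶ Z) : ∃ y : G ⟶ Y, y ≫ g = x := by
  obtain ⟨y, hy⟩ := Ext.covariant_sequence_exact₃ G h.2 (Ext.mk₀ x) (zero_add 1)
    (Subsingleton.elim _ _)
  obtain ⟨y, rfl⟩ := Ext.homEquiv₀.symm.surjective y
  refine ⟨y, Ext.homEquiv₀.symm.injective ?_⟩
  exact (Ext.mk₀_comp_mk₀ y g).symm.trans hy

end ExtSequences

section Gorenstein

lemma exists_int_chain {T : Type*} {P Q : T → Prop} {R : T → T → Prop} (hPQ : ∀ s, P s → Q s)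
    (hnext : ∀ s, P s → ∃ t, P t ∧ R s t) (hprev : ∀ t, Q t → ∃ s, Q s ∧ R s t) {s₀ : T}
    (h₀ : P s₀) :
    ∃ Z : ℤ → T, Z 1 = s₀ ∧ (∀ n, Q (Z n)) ∧ ∀ n, R (Z n) (Z (n + 1)) := by
  choose! next hnextP hnextR using hnext
  choose! prev hprevQ hprevR using hprev
  let W : ℤ → T := fun n => match n with
    | Int.ofNat k => next^[k] s₀
    | Int.negSucc k => prev^[k + 1] s₀
  have hP : ∀ k : ℕ, P (next^[k] s₀) := fun k => by
    induction k with
    | zero => exact h₀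
    | succ k ih => rw [Function.iterate_succ_apply']; exact hnextP _ ih
  have hQ : ∀ k : ℕ, Q (prev^[k] s₀) := fun k => by
    induction k with
    | zero => exact hPQ _ h₀
    | succ k ih => rw [Function.iterate_succ_apply']; exact hprevQ _ ih
  have hWQ : ∀ n, Q (W n) := by
    rintro (k | k)
    · exact hPQ _ (hP k)
    · exact hQ (k + 1)
  have hWR : ∀ n, R (W n) (W (n + 1)) := by
    rintro (k | _ | k)
    · change R (next^[k] s₀) (next^[k + 1] s₀)
      rw [Function.iterate_succ_apply']
      exact hnextR _ (hP k)
    · exact hprevR _ (hQ 0)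
    · change R (prev^[k + 1 + 1] s₀) (prev^[k + 1] s₀)
      rw [Function.iterate_succ_apply' prev (k + 1)]
      exact hprevR _ (hQ (k + 1))
  refine ⟨fun n => W (n - 1), rfl, fun n => hWQ _, fun n => ?_⟩
  have := hWR (n - 1)
  rwa [show n - 1 + 1 = n + 1 - 1 by ring] at this

variable [HasExt.{w} A]

lemma ext_subsingleton_of_iso_left {M N T : A} (e : M ≅ N) {i : ℕ}
    (h : Subsingleton (Ext N T i)) : Subsingleton (Ext M T i) := by
  refine subsingleton_of_forall_eq 0 fun x => ?_
  rw [← Ext.mk₀_id_comp x, ← e.hom_inv_id, ← Ext.mk₀_comp_mk₀_assoc,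
    Subsingleton.elim ((Ext.mk₀ e.inv).comp x (zero_add i)) 0, Ext.comp_zero]

lemma ext_subsingleton_of_iso_right {G M N : A} (e : M ≅ N) {i : ℕ}
    (h : Subsingleton (Ext G N i)) : Subsingleton (Ext G M i) := by
  refine subsingleton_of_forall_eq 0 fun x => ?_
  rw [← Ext.comp_mk₀_id x, ← e.hom_inv_id, ← Ext.mk₀_comp_mk₀,
    ← Ext.comp_assoc_of_third_deg_zero, Subsingleton.elim (x.comp (Ext.mk₀ e.hom) (add_zero i)) 0,
    Ext.zero_comp]

/-- `Ext^i(M, C) = 0` for all `i ≥ 1` and all `C` in `𝒞`. -/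
def ExtOrthogonal (𝒞 : A → Prop) (M : A) : Prop :=
  ∀ ⦃C : A⦄, 𝒞 C → ∀ i : ℕ, Subsingleton (Ext M C (1 + i))

lemma IsGorenstein.exists_cosyzygy {𝒞 : A → Prop} {M : A} (h : IsGorenstein 𝒞 M) :
    ∃ (C M' : A) (i : M ⟶ C) (p : C ⟶ M'), 𝒞 C ∧ IsGorenstein 𝒞 M' ∧ IsSES i p := by
  obtain ⟨X, d, hw, hC, hex, hl, hr, ⟨e⟩⟩ := h
  refine ⟨X (0 + 1), image (d (0 + 1)), _, _, hC _, ⟨fun n => X (n + 1), fun n => d (n + 1),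
    fun n => hw _, fun n => hC _, fun n => hex _, fun n => hl _, fun n => hr _, ⟨Iso.refl _⟩⟩,
    (isSES_image (hw 0) (hex 0)).iso_left e⟩

/-- `𝒞` is additive and a projective generator for the ambient abelian category. -/
structure IsProjectiveGenerator (𝒞 : A → Prop) : Prop where
  additive : IsAdditiveClosed 𝒞
  exists_cover : ∀ X : A, ∃ (K C : A) (f : K ⟶ C) (g : C ⟶ X), 𝒞 C ∧ IsSES f g
  ext_subsingleton : ∀ ⦃C : A⦄, 𝒞 C → ∀ (X : A) (i : ℕ), Subsingleton (Ext C X (1 + i))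

namespace IsProjectiveGenerator

variable {𝒞 : A → Prop}

lemma extOrthogonal_of_isGorenstein (h𝒞 : IsProjectiveGenerator 𝒞) {M : A}
    (h : IsGorenstein 𝒞 M) : ExtOrthogonal 𝒞 M := by
  obtain ⟨X, d, hw, hC, hex, hl, hr, ⟨e⟩⟩ := h
  intro C hCC i
  refine ext_subsingleton_of_iso_left e ?_
  suffices ∀ (i : ℕ) (n : ℤ), Subsingleton (Ext (image (d n)) C (1 + i)) from this i 0
  intro i
  induction i with
  | zero =>
    intro n
    obtain ⟨k, rfl⟩ : ∃ k : ℤ, n = k + 1 + 1 := ⟨n - 2, by ring⟩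
    refine (isSES_image (hw _) (hex _)).ext_right_of_extend (fun x => ?_)
      (h𝒞.ext_subsingleton (hC _) _ 0)
    obtain ⟨y, hy⟩ := (hr k hCC (factorThruImage (d (k + 1)) ≫ x)).1 (by
      change d k ≫ factorThruImage (d (k + 1)) ≫ x = 0
      rw [← Limits.image.fac (d k), Category.assoc, ← Category.assoc (Limits.image.ι (d k)),
        (isSES_image (hw k) (hex k)).zero, zero_comp, comp_zero])
    refine ⟨y, ?_⟩
    rw [← cancel_epi (factorThruImage (d (k + 1))), Limits.image.fac_assoc]
    exact hy
  | succ i ih =>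
    intro n
    obtain ⟨k, rfl⟩ : ∃ k : ℤ, n = k + 1 := ⟨n - 1, by ring⟩
    rw [Nat.add_comm i 1]
    exact (isSES_image (hw _) (hex _)).ext_right_of_left (ih k)
      (h𝒞.ext_subsingleton (hC _) _ _)

/-- A class of objects left orthogonal to `𝒞` and closed under taking some cosyzygy with middle
term in `𝒞` consists of objects of the Gorenstein subcategory. -/
lemma isGorenstein_of_cosyzygies (h𝒞 : IsProjectiveGenerator 𝒞) {S : A → Prop}
    (hS : ∀ M, S M → ExtOrthogonal 𝒞 M)
    (hnext : ∀ M, S M → ∃ (C M' : A) (i : M ⟶ C) (p : C ⟶ M'), 𝒞 C ∧ S M' ∧ IsSES i p)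
    {M : A} (hM : S M) : IsGorenstein 𝒞 M := by
  obtain ⟨Z, rfl, hQ, hR⟩ := exists_int_chain (Q := ExtOrthogonal 𝒞)
    (R := fun M M' => ∃ (C : A) (i : M ⟶ C) (p : C ⟶ M'), 𝒞 C ∧ IsSES i p) hS
    (fun M hM => by
      obtain ⟨C, M', i, p, hC, hM', h⟩ := hnext M hM
      exact ⟨M', hM', C, i, p, hC, h⟩)
    (fun M hM => by
      obtain ⟨K, C, i, p, hC, h⟩ := h𝒞.exists_cover M
      refine ⟨K, fun D hD j => h.ext_left_of_middle (h𝒞.ext_subsingleton hC _ _) ?_,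
        C, i, p, hC, h⟩
      exact hM hD _)
    hM
  choose X i p hX hZ using hR
  have hm : ∀ n, Mono (i n) := fun n => (hZ n).mono
  have he : ∀ n, Epi (p n) := fun n => (hZ n).epi
  have hw : ∀ n, (p n ≫ i (n + 1)) ≫ p (n + 1) ≫ i (n + 1 + 1) = 0 := fun n => by
    rw [Category.assoc, ← Category.assoc (i (n + 1)), (hZ (n + 1)).zero, zero_comp, comp_zero]
  have := strongEpi_of_epi (p 0)
  have e := image.isoStrongEpiMono (p 0) (i (0 + 1)) rfl
  refine ⟨X, fun n => p n ≫ i (n + 1), hw, hX, fun n => ?_, fun n C hC y => ⟨fun hy => ?_, ?_⟩,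
    fun n C hC y => ⟨fun hy => ?_, ?_⟩, ⟨e⟩⟩
  · rw [ShortComplex.exact_iff_exact_up_to_refinements]
    intro T x hx
    obtain ⟨y, rfl⟩ := (hZ (n + 1)).exists_lift x (by
      rw [← cancel_mono (i (n + 1 + 1)), zero_comp, Category.assoc]; exact hx)
    obtain ⟨T', π, hπ, z, hz⟩ := surjective_up_to_refinements_of_epi (p n) y
    exact ⟨T', π, hπ, z, by simp only [← Category.assoc, hz]⟩
  · obtain ⟨z, rfl⟩ := (hZ (n + 1)).exists_lift y (by
      rw [← cancel_mono (i (n + 1 + 1)), zero_comp, Category.assoc]; exact hy)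
    obtain ⟨t, rfl⟩ := (hZ n).exists_lift_of_ext (h𝒞.ext_subsingleton hC _ 0) z
    exact ⟨t, (Category.assoc _ _ _).symm⟩
  · rintro ⟨z, rfl⟩
    change (z ≫ p n ≫ i (n + 1)) ≫ p (n + 1) ≫ i (n + 1 + 1) = 0
    rw [Category.assoc, hw, comp_zero]
  · obtain ⟨z, rfl⟩ := (hZ (n + 1)).exists_desc y (by
      rw [← cancel_epi (p n), comp_zero, ← Category.assoc]; exact hy)
    obtain ⟨t, rfl⟩ := (hZ (n + 1 + 1)).exists_extend (hQ _ hC 0) z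
    exact ⟨t, Category.assoc _ _ _⟩
  · rintro ⟨z, rfl⟩
    change (p n ≫ i (n + 1)) ≫ (p (n + 1) ≫ i (n + 1 + 1)) ≫ z = 0
    rw [← Category.assoc, hw, zero_comp]

lemma isGorenstein_of_cosyzygy (h𝒞 : IsProjectiveGenerator 𝒞) {M C M' : A} {i : M ⟶ C}
    {p : C ⟶ M'} (hM : ExtOrthogonal 𝒞 M) (hC : 𝒞 C) (hM' : IsGorenstein 𝒞 M')
    (h : IsSES i p) : IsGorenstein 𝒞 M := by
  refine h𝒞.isGorenstein_of_cosyzygies (S := fun N => ExtOrthogonal 𝒞 N ∧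
    ∃ (C N' : A) (i : N ⟶ C) (p : C ⟶ N'), 𝒞 C ∧ IsGorenstein 𝒞 N' ∧ IsSES i p)
    (fun _ hN => hN.1) ?_ ⟨hM, C, M', i, p, hC, hM', h⟩
  rintro N ⟨-, D, N', j, q, hD, hN', hjq⟩
  exact ⟨D, N', j, q, hD, ⟨h𝒞.extOrthogonal_of_isGorenstein hN', hN'.exists_cosyzygy⟩, hjq⟩

lemma isGorenstein_of_syzygy (h𝒞 : IsProjectiveGenerator 𝒞) {K C M : A} {i : K ⟶ C}
    {p : C ⟶ M} (hC : 𝒞 C) (hM : IsGorenstein 𝒞 M) (h : IsSES i p) : IsGorenstein 𝒞 K :=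
  h𝒞.isGorenstein_of_cosyzygy (fun _ hD _ => h.ext_left_of_middle
    (h𝒞.ext_subsingleton hC _ _) (h𝒞.extOrthogonal_of_isGorenstein hM hD _)) hC hM h

lemma isGorenstein_of_mem (h𝒞 : IsProjectiveGenerator 𝒞) {C : A} (hC : 𝒞 C) :
    IsGorenstein 𝒞 C :=
  h𝒞.isGorenstein_of_cosyzygies (S := 𝒞) (fun _ hM _ _ i => h𝒞.ext_subsingleton hM _ i)
    (fun M hM => ⟨M, 0, 𝟙 M, 0, hM, h𝒞.additive.2.1, isSES_id_zero M⟩) hC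

lemma isGorenstein_extension (h𝒞 : IsProjectiveGenerator 𝒞) {X Y Z : A} {f : X ⟶ Y}
    {g : Y ⟶ Z} (h : IsSES f g) (hX : IsGorenstein 𝒞 X) (hZ : IsGorenstein 𝒞 Z) :
    IsGorenstein 𝒞 Y := by
  refine h𝒞.isGorenstein_of_cosyzygies (S := fun N => ∃ (X Z : A) (f : X ⟶ N) (g : N ⟶ Z),
    IsGorenstein 𝒞 X ∧ IsGorenstein 𝒞 Z ∧ IsSES f g) ?_ ?_ ⟨X, Z, f, g, hX, hZ, h⟩
  · rintro N ⟨X, Z, f, g, hX, hZ, h⟩ C hC i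
    exact h.ext_middle_left (h𝒞.extOrthogonal_of_isGorenstein hX hC i)
      (h𝒞.extOrthogonal_of_isGorenstein hZ hC i)
  · rintro N ⟨X, Z, f, g, hX, hZ, h⟩
    obtain ⟨C, X', i, p, hC, hX', hip⟩ := hX.exists_cosyzygy
    obtain ⟨D, Z', j, q, hD, hZ', hjq⟩ := hZ.exists_cosyzygy
    obtain ⟨t, ht⟩ := h.exists_extend (h𝒞.extOrthogonal_of_isGorenstein hZ hC 0) i
    obtain ⟨Q, r, u, v, hr, huv⟩ := IsSES.exists_cokernels h (isSES_biprod C D)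
      (b := biprod.lift t (g ≫ j))
      (by ext <;> simp [ht, reassoc_of% h.zero]) (by simp) hip hjq
    exact ⟨C ⊞ D, Q, _, r, h𝒞.additive.2.2 hC hD, ⟨X', Z', u, v, hX', hZ', huv⟩, hr⟩

lemma isGorenstein_kernel (h𝒞 : IsProjectiveGenerator 𝒞) {X Y Z : A} {f : X ⟶ Y}
    {g : Y ⟶ Z} (h : IsSES f g) (hY : IsGorenstein 𝒞 Y) (hZ : IsGorenstein 𝒞 Z) :
    IsGorenstein 𝒞 X := by
  obtain ⟨C, Y', i, p, hC, hY', hip⟩ := hY.exists_cosyzygy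
  obtain ⟨Q, q, u, v, hq, huv⟩ := IsSES.comp hip.op h.op
  refine h𝒞.isGorenstein_of_cosyzygy (fun D hD j => h.ext_left_of_middle
    (h𝒞.extOrthogonal_of_isGorenstein hY hD j) (h𝒞.extOrthogonal_of_isGorenstein hZ hD _)) hC ?_
    hq.unop
  exact h𝒞.isGorenstein_extension huv.unop hZ hY'

lemma exists_syzygy (h𝒞 : IsProjectiveGenerator 𝒞) {G : A} (hG : IsGorenstein 𝒞 G) :
    ∃ (K C : A) (i : K ⟶ C) (p : C ⟶ G), IsGorenstein 𝒞 K ∧ 𝒞 C ∧ IsSES i p := by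
  obtain ⟨K, C, i, p, hC, h⟩ := h𝒞.exists_cover G
  exact ⟨K, C, i, p, h𝒞.isGorenstein_of_syzygy hC hG h, hC, h⟩

lemma rightPerp1_of_mem (h𝒞 : IsProjectiveGenerator 𝒞) {C : A} (hC : 𝒞 C) : RightPerp1 𝒞 C :=
  fun _ hG => h𝒞.extOrthogonal_of_isGorenstein hG hC 0

lemma ext_two_subsingleton (h𝒞 : IsProjectiveGenerator 𝒞) {T G : A} (hT : RightPerp1 𝒞 T)
    (hG : IsGorenstein 𝒞 G) : Subsingleton (Ext G T (1 + 1)) := by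
  obtain ⟨K, C, i, p, hK, hC, h⟩ := h𝒞.exists_syzygy hG
  exact h.ext_right_of_left (hT hK) (h𝒞.ext_subsingleton hC _ _)

lemma rightPerp1_quotient (h𝒞 : IsProjectiveGenerator 𝒞) {X Y Z : A} {f : X ⟶ Y}
    {g : Y ⟶ Z} (h : IsSES f g) (hX : RightPerp1 𝒞 X) (hY : RightPerp1 𝒞 Y) :
    RightPerp1 𝒞 Z :=
  fun _ hG => h.ext_target_right (hY hG) (h𝒞.ext_two_subsingleton hX hG)

lemma hasSpecialPrecover_of_isSES {K G M : A} {k : K ⟶ G} {f : G ⟶ M} (h : IsSES k f)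
    (hG : IsGorenstein 𝒞 G) (hK : RightPerp1 𝒞 K) : HasSpecialPrecover 𝒞 M := by
  have := h.mono
  obtain ⟨t, ht⟩ := h.exists_lift (kernel.ι f) (kernel.condition f)
  have e : kernel f ≅ K :=
    { hom := t
      inv := kernel.lift f k h.zero
      hom_inv_id := by rw [← cancel_mono (kernel.ι f)]; simp [ht]
      inv_hom_id := by rw [← cancel_mono k]; simp [ht] }
  exact ⟨G, f, hG, h.epi, fun G' hG' => ext_subsingleton_of_iso_right e (hK hG'),
    fun G' hG' x => h.exists_lift_of_ext (hK hG') x⟩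

lemma exists_isSES_of_hasSpecialPrecover {M : A} (h : HasSpecialPrecover 𝒞 M) :
    ∃ (K G : A) (k : K ⟶ G) (f : G ⟶ M), IsGorenstein 𝒞 G ∧ RightPerp1 𝒞 K ∧ IsSES k f := by
  obtain ⟨G, f, hG, hf, hK, -⟩ := h
  exact ⟨_, G, _, f, hG, hK, isSES_kernel f hf⟩

/-- An object `M` to which maps from Gorenstein objects factor through every epimorphism from an
object of `𝒞` has a special precover. -/
lemma hasSpecialPrecover_of_exists_lift (h𝒞 : IsProjectiveGenerator 𝒞) {M : A}
    (hM : ∀ ⦃G C : A⦄ (q : C ⟶ M) (x : G ⟶ M), IsGorenstein 𝒞 G → 𝒞 C → Epi q →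
      ∃ y : G ⟶ C, y ≫ q = x) : HasSpecialPrecover 𝒞 M := by
  obtain ⟨K, C, i, p, hC, h⟩ := h𝒞.exists_cover M
  exact hasSpecialPrecover_of_isSES h (h𝒞.isGorenstein_of_mem hC) fun G hG =>
    h.ext_target_left_of_lift (fun x => hM p x hG hC h.epi) (h𝒞.rightPerp1_of_mem hC hG)

lemma hasSpecialPrecover_of_projective (h𝒞 : IsProjectiveGenerator 𝒞) {P : A}
    (hP : Projective P) : HasSpecialPrecover 𝒞 P := by
  refine h𝒞.hasSpecialPrecover_of_exists_lift fun G C q x _ _ hq => ?_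
  exact ⟨x ≫ Projective.factorThru (𝟙 P) q, by simp⟩

lemma hasSpecialPrecover_of_exists_extend (h𝒞 : IsProjectiveGenerator 𝒞) {M : A}
    (hM : ∀ ⦃G C G' : A⦄ (i : G ⟶ C) (p : C ⟶ G') (x : G ⟶ M), IsGorenstein 𝒞 G' →
      IsSES i p → ∃ y : C ⟶ M, i ≫ y = x) : HasSpecialPrecover 𝒞 M := by
  refine h𝒞.hasSpecialPrecover_of_exists_lift fun G C q x hG _ hq => ?_
  obtain ⟨D, G', i, p, hD, hG', h⟩ := hG.exists_cosyzygy
  obtain ⟨y, rfl⟩ := hM i p x hG' h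
  obtain ⟨z, rfl⟩ := (isSES_kernel q hq).exists_lift_of_ext (h𝒞.ext_subsingleton hD _ 0) y
  exact ⟨i ≫ z, Category.assoc _ _ _⟩

lemma hasSpecialPrecover_of_rightPerp1 (h𝒞 : IsProjectiveGenerator 𝒞) {T : A}
    (hT : RightPerp1 𝒞 T) : HasSpecialPrecover 𝒞 T :=
  h𝒞.hasSpecialPrecover_of_exists_extend fun _ _ _ _ _ x hG' h => h.exists_extend (hT hG') x

lemma hasSpecialPrecover_of_injective (h𝒞 : IsProjectiveGenerator 𝒞) {I : A}
    (hI : Injective I) : HasSpecialPrecover 𝒞 I :=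
  h𝒞.hasSpecialPrecover_of_exists_extend fun _ _ _ i _ x _ h =>
    have := h.mono
    ⟨Injective.factorThru x i, Injective.comp_factorThru x i⟩

lemma hasSpecialPrecover_extension (h𝒞 : IsProjectiveGenerator 𝒞) {L M N : A} {f : L ⟶ M}
    {g : M ⟶ N} (h : IsSES f g) (hL : HasSpecialPrecover 𝒞 L) (hN : HasSpecialPrecover 𝒞 N) :
    HasSpecialPrecover 𝒞 M := by
  obtain ⟨K₁, G₁, k₁, a, hG₁, hK₁, h₁⟩ := exists_isSES_of_hasSpecialPrecover hL
  obtain ⟨K₃, G₃, k₃, c, hG₃, hK₃, h₃⟩ := exists_isSES_of_hasSpecialPrecover hN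
  obtain ⟨H, C, i, p, hH, hC, hip⟩ := h𝒞.exists_syzygy hG₃
  obtain ⟨s, hs⟩ := h.exists_lift_of_ext (h𝒞.ext_subsingleton hC _ 0) (p ≫ c)
  obtain ⟨t, ht⟩ := h.exists_lift (i ≫ s)
    (by rw [Category.assoc, hs, ← Category.assoc, hip.zero, zero_comp])
  obtain ⟨r, hr⟩ := h₁.exists_lift_of_ext (hK₁ hH) t
  have sq := IsPushout.of_hasPushout i r
  obtain ⟨q, hq, hG⟩ := IsSES.of_isPushout sq hip
  have w : i ≫ s = r ≫ a ≫ f := by rw [← Category.assoc, hr, ht]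
  obtain ⟨K, k, u, v, hk, huv⟩ := IsSES.exists_kernels hG h (b := sq.desc s (a ≫ f) w)
    (sq.inr_desc _ _ _) (by
      apply sq.hom_ext
      · rw [← Category.assoc, hq, sq.inl_desc_assoc, hs]
      · rw [← Category.assoc, hG.zero, sq.inr_desc_assoc, Category.assoc, h.zero, zero_comp,
          comp_zero]) h₁ h₃
  exact hasSpecialPrecover_of_isSES hk (h𝒞.isGorenstein_extension hG hG₁ hG₃)
    fun G' hG' => huv.ext_middle_right (hK₁ hG') (hK₃ hG')

lemma hasSpecialPrecover_kernel (h𝒞 : IsProjectiveGenerator 𝒞) {L M N : A} {f : L ⟶ M}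
    {g : M ⟶ N} (h : IsSES f g) (hM : HasSpecialPrecover 𝒞 M) (hN : HasSpecialPrecover 𝒞 N) :
    HasSpecialPrecover 𝒞 L := by
  obtain ⟨K₃, G₃, k₃, c, hG₃, hK₃, h₃⟩ := exists_isSES_of_hasSpecialPrecover hN
  have sq := IsPullback.of_hasPullback g c
  obtain ⟨f', -, hf'⟩ := IsSES.of_isPullback sq h
  obtain ⟨k₃', -, hk₃'⟩ := IsSES.of_isPullback sq.flip h₃
  obtain ⟨K, G, k, b, hG, hK, hkb⟩ := exists_isSES_of_hasSpecialPrecover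
    (h𝒞.hasSpecialPrecover_extension hk₃' (h𝒞.hasSpecialPrecover_of_rightPerp1 hK₃) hM)
  obtain ⟨G', j, u, v, hj, huv⟩ := IsSES.comp hkb hf'
  exact hasSpecialPrecover_of_isSES huv (h𝒞.isGorenstein_kernel hj hG hG₃) hK

lemma hasSpecialPrecover_cokernel (h𝒞 : IsProjectiveGenerator 𝒞) {L M N : A} {f : L ⟶ M}
    {g : M ⟶ N} (h : IsSES f g) (hL : HasSpecialPrecover 𝒞 L) (hM : HasSpecialPrecover 𝒞 M) :
    HasSpecialPrecover 𝒞 N := by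
  obtain ⟨K₂, G₂, k₂, b, hG₂, hK₂, h₂⟩ := exists_isSES_of_hasSpecialPrecover hM
  obtain ⟨L', j, u, v, hj, huv⟩ := IsSES.comp h₂ h
  obtain ⟨K, G, k, a, hG, hK, hka⟩ := exists_isSES_of_hasSpecialPrecover
    (h𝒞.hasSpecialPrecover_extension huv (h𝒞.hasSpecialPrecover_of_rightPerp1 hK₂) hL)
  obtain ⟨C, G', i, p, hC, hG', hip⟩ := hG.exists_cosyzygy
  obtain ⟨E, e, u', v', he, hE⟩ := IsSES.comp hip.op hka.op
  have sq := IsPushout.of_hasPushout v'.unop j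
  obtain ⟨q, -, hq⟩ := IsSES.of_isPushout sq hE.unop
  obtain ⟨r, -, hr⟩ := IsSES.of_isPushout sq.flip hj
  exact hasSpecialPrecover_of_isSES hr (h𝒞.isGorenstein_extension hq hG₂ hG')
    (h𝒞.rightPerp1_quotient he.unop hK (h𝒞.rightPerp1_of_mem hC))

end IsProjectiveGenerator

end Gorenstein

/-- if `𝒞` is a projective generator for `A`, then `spc(𝒢(𝒞))` is
projectively resolving and injectively coresolving in `A`. -/
theorem stmt_19 [HasExt.{w} A] (𝒞 : A → Prop) (hadd : IsAdditiveClosed 𝒞)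
    (hso : SelfOrthogonal 𝒞) (hgen : ProjIsGeneratorFor 𝒞)
    (hCgenA : ∀ X : A, ∃ (K C : A) (f : K ⟶ C) (g : C ⟶ X), 𝒞 C ∧ IsSES f g)
    (hCproj : ∀ ⦃C : A⦄, 𝒞 C → ∀ (X : A) (i : ℕ), 1 ≤ i →
      Subsingleton (Abelian.Ext C X i)) :
    (∀ P : A, Projective P → HasSpecialPrecover 𝒞 P) ∧
    (∀ ⦃L M N : A⦄ (f : L ⟶ M) (g : M ⟶ N), IsSES f g →
      HasSpecialPrecover 𝒞 L → HasSpecialPrecover 𝒞 N → HasSpecialPrecover 𝒞 M) ∧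
    (∀ ⦃L M N : A⦄ (f : L ⟶ M) (g : M ⟶ N), IsSES f g →
      HasSpecialPrecover 𝒞 M → HasSpecialPrecover 𝒞 N → HasSpecialPrecover 𝒞 L) ∧
    (∀ I : A, Injective I → HasSpecialPrecover 𝒞 I) ∧
    (∀ ⦃L M N : A⦄ (f : L ⟶ M) (g : M ⟶ N), IsSES f g →
      HasSpecialPrecover 𝒞 L → HasSpecialPrecover 𝒞 M → HasSpecialPrecover 𝒞 N) := by
  have h𝒞 : IsProjectiveGenerator 𝒞 :=
    ⟨hadd, hCgenA, fun C hC X i => hCproj hC X (1 + i) (Nat.le_add_right 1 i)⟩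
  exact ⟨fun _ hP => h𝒞.hasSpecialPrecover_of_projective hP,
    fun _ _ _ _ _ h hL hN => h𝒞.hasSpecialPrecover_extension h hL hN,
    fun _ _ _ _ _ h hM hN => h𝒞.hasSpecialPrecover_kernel h hM hN,
    fun _ hI => h𝒞.hasSpecialPrecover_of_injective hI,
    fun _ _ _ _ _ h hL hM => h𝒞.hasSpecialPrecover_cokernel h hL hM⟩
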